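/- arXiv:2204.07667 — 2 statements merged into one kernel-verified Lean document; each statement's English description precedes it below -/
import Mathlib

section
/- Adaptive composition of differentially private mechanisms: let X be a type of datasets with a neighboring relation N, let Θ and Ω be measurable spaces, let M₁ : X → Measure Θ be a mechanism satisfying (ε₁,δ₁)-differential privacy with respect to N, and let M₂ : Θ → X → Measure Ω be such that θ ↦ M₂ θ x is a Markov kernel for each x and, for every θ ∈ Θ, the mechanism x ↦ M₂ θ x satisfies (ε₂,δ₂)-differential privacy with respect to N. Then the composed mechanism x ↦ (M₁ x).bind (fun θ => M₂ θ x) satisfies (ε₁+ε₂, δ₁+δ₂)-differential privacy with respect to N, where ε₁, ε₂ ≥ 0 and δ₁, δ₂ ≥ 0. -/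
open MeasureTheory ProbabilityTheory

/-- A mechanism `M : X → Measure Ω` satisfies `(ε, δ)`-differential privacy with respect
to a neighboring relation `N` on `X` if for all neighboring `x, x'` and every measurable
set `T`, `M x T ≤ exp ε * M x' T + δ`. -/
def IsDP {X : Type*} {Ω : Type*} [MeasurableSpace Ω] (M : X → Measure Ω)
    (N : X → X → Prop) (ε δ : ℝ) : Prop :=
  ∀ x x', N x x' → ∀ T : Set Ω, MeasurableSet T →
    M x T ≤ ENNReal.ofReal (Real.exp ε) * M x' T + ENNReal.ofReal δ

/-- If `μ T ≤ c * ν T + d` on measurable sets, then the same inequality holds for the integrals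
of measurable functions with values in `[0, 1]`. -/
theorem lintegral_le_mul_lintegral_add_of_le_one {α : Type*} [MeasurableSpace α]
    {μ ν : Measure α} {c d : ENNReal}
    (h : ∀ T, MeasurableSet T → μ T ≤ c * ν T + d)
    {f : α → ENNReal} (hf : Measurable f) (hf_le : ∀ a, f a ≤ 1) :
    ∫⁻ a, f a ∂μ ≤ c * ∫⁻ a, f a ∂ν + d := by
  have layercake (ρ : Measure α) :
      ∫⁻ a, f a ∂ρ = ∫⁻ t in Set.Ioo (0 : ℝ) 1, ρ {a | t < (f a).toReal} := by
    have hcake := lintegral_eq_lintegral_meas_lt ρ (f := fun a => (f a).toReal)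
      (ae_of_all _ fun _ => ENNReal.toReal_nonneg) hf.ennreal_toReal.aemeasurable
    simp only [ENNReal.ofReal_toReal ((hf_le _).trans_lt ENNReal.one_lt_top).ne] at hcake
    rw [hcake]
    rw [← lintegral_inter_add_sdiff _ (Set.Ioi 0) measurableSet_Iio (B := Set.Iio 1),
      Set.Ioi_inter_Iio, setLIntegral_eq_zero (measurableSet_Ioi.diff measurableSet_Iio),
      add_zero]
    intro t ht
    have ht_one : 1 ≤ t := not_lt.mp ht.2
    have hempty : {a | t < (f a).toReal} = ∅ := Set.eq_empty_of_forall_notMem fun a ha =>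
      (ht_one.trans_lt ha).not_ge (by simpa using ENNReal.toReal_mono ENNReal.one_ne_top (hf_le a))
    simp [hempty]
  have hmeas : Measurable fun t : ℝ => ν {a | t < (f a).toReal} :=
    Antitone.measurable fun _ _ hst => measure_mono fun _ ha => hst.trans_lt ha
  rw [layercake μ, layercake ν]
  calc ∫⁻ t in Set.Ioo (0 : ℝ) 1, μ {a | t < (f a).toReal}
      ≤ ∫⁻ t in Set.Ioo (0 : ℝ) 1, (c * ν {a | t < (f a).toReal} + d) :=
        lintegral_mono fun t => h _ (measurableSet_lt measurable_const hf.ennreal_toReal)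
    _ = c * (∫⁻ t in Set.Ioo (0 : ℝ) 1, ν {a | t < (f a).toReal}) + d := by
        rw [lintegral_add_right _ measurable_const, lintegral_const_mul _ hmeas]
        simp

/-- Adaptive composition of differentially private mechanisms: if `M₁` is `(ε₁, δ₁)`-DP and,
for each intermediate output `θ`, the mechanism `x ↦ M₂ x θ` is `(ε₂, δ₂)`-DP (where for each
dataset `x` the map `θ ↦ M₂ x θ` is a Markov kernel), then the composition
`x ↦ (M₁ x).bind (M₂ x)` is `(ε₁ + ε₂, δ₁ + δ₂)`-DP. -/
theorem dp_adaptive_composition {X : Type*} {Θ Ω : Type*}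
    [MeasurableSpace Θ] [MeasurableSpace Ω]
    (N : X → X → Prop) (ε₁ ε₂ δ₁ δ₂ : ℝ)
    (hε₁ : 0 ≤ ε₁) (hε₂ : 0 ≤ ε₂) (hδ₁ : 0 ≤ δ₁) (hδ₂ : 0 ≤ δ₂)
    (M₁ : X → Measure Θ) (hM₁ : ∀ x, IsProbabilityMeasure (M₁ x))
    (M₂ : X → Kernel Θ Ω) (hM₂ : ∀ x, IsMarkovKernel (M₂ x))
    (hDP₁ : IsDP M₁ N ε₁ δ₁)
    (hDP₂ : ∀ θ : Θ, IsDP (fun x => M₂ x θ) N ε₂ δ₂) :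
    IsDP (fun x => (M₁ x).bind (M₂ x)) N (ε₁ + ε₂) (δ₁ + δ₂) := by
  intro x x' hN T hT
  have := hM₁ x
  have := hM₂ x
  rw [Measure.bind_apply hT (M₂ x).aemeasurable, Measure.bind_apply hT (M₂ x').aemeasurable,
    Real.exp_add, ENNReal.ofReal_mul (Real.exp_pos _).le, ENNReal.ofReal_add hδ₁ hδ₂]
  set c₁ := ENNReal.ofReal (Real.exp ε₁)
  set c₂ := ENNReal.ofReal (Real.exp ε₂)
  have hmeas' : Measurable fun θ => M₂ x' θ T := (M₂ x').measurable_coe hT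
  have hmeas : Measurable fun θ => min 1 (c₂ * M₂ x' θ T) :=
    measurable_const.min (hmeas'.const_mul c₂)
  calc ∫⁻ θ, M₂ x θ T ∂M₁ x
      ≤ ∫⁻ θ, (min 1 (c₂ * M₂ x' θ T) + ENNReal.ofReal δ₂) ∂M₁ x := by
        refine lintegral_mono fun θ => ?_
        rw [min_add]
        exact le_min (prob_le_one.trans le_self_add) (hDP₂ θ x x' hN T hT)
    _ = ∫⁻ θ, min 1 (c₂ * M₂ x' θ T) ∂M₁ x + ENNReal.ofReal δ₂ := by
        rw [lintegral_add_right _ measurable_const]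
        simp
    _ ≤ c₁ * ∫⁻ θ, min 1 (c₂ * M₂ x' θ T) ∂M₁ x' + ENNReal.ofReal δ₁ + ENNReal.ofReal δ₂ := by
        gcongr
        exact lintegral_le_mul_lintegral_add_of_le_one (hDP₁ x x' hN) hmeas
          fun _ => min_le_left _ _
    _ ≤ c₁ * ∫⁻ θ, c₂ * M₂ x' θ T ∂M₁ x' + ENNReal.ofReal δ₁ + ENNReal.ofReal δ₂ := by
        gcongr
        exact min_le_right _ _
    _ = c₁ * c₂ * ∫⁻ θ, M₂ x' θ T ∂M₁ x' + (ENNReal.ofReal δ₁ + ENNReal.ofReal δ₂) := by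
        rw [lintegral_const_mul _ hmeas', mul_assoc, add_assoc]
end

section
/- Iterated adaptive composition of differentially private mechanisms: let X be a type of datasets with a neighboring relation N, let k ∈ ℕ, and for each i < k let M_i : Θ → X → Measure Θ be a mechanism update (with Θ a measurable space of states, e.g., model parameters) such that θ ↦ M_i θ x is a Markov kernel for each x, and for every fixed state θ the mechanism x ↦ M_i θ x satisfies (ε_i, δ_i)-differential privacy with respect to N (ε_i, δ_i ≥ 0). Then for any initial state θ₀, the k-step composed mechanism x ↦ sequential bind of M_0 θ₀ x, then M_1 · x, …, then M_{k-1} · x, satisfies (Σ_{i<k} ε_i, Σ_{i<k} δ_i)-differential privacy with respect to N. -/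
open MeasureTheory ProbabilityTheory

/-- The `k`-step sequential composition of the mechanism updates `M i x : Kernel Θ Θ`,
started from the initial state `θ₀` on the dataset `x`:  run `M 0 · x` on `θ₀`, then
`M 1 · x` on the result, …, then `M (k-1) · x`. -/
noncomputable def iterComp {X : Type*} {Θ : Type*} [MeasurableSpace Θ]
    (M : ℕ → X → Kernel Θ Θ) (θ₀ : Θ) (x : X) : ℕ → Measure Θ
  | 0 => Measure.dirac θ₀
  | k + 1 => (iterComp M θ₀ x k).bind (M k x)

/-- Approximate domination on measurable sets passes to integrals of functions with values
in `[0, 1]`. -/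
lemma lintegral_le_of_measure_le_add {Ω : Type*} [MeasurableSpace Ω] {μ ν : Measure Ω}
    {c d : ENNReal} (hc : c ≠ ⊤)
    (h : ∀ T, MeasurableSet T → μ T ≤ c * ν T + d)
    {f : Ω → ENNReal} (hf : Measurable f) (hf1 : ∀ ω, f ω ≤ 1) :
    ∫⁻ ω, f ω ∂μ ≤ c * ∫⁻ ω, f ω ∂ν + d := by
  have layer_cake (ρ : Measure Ω) :
      ∫⁻ ω, f ω ∂ρ = ∫⁻ t in Set.Ioc (0 : ℝ) 1, ρ {ω | t ≤ (f ω).toReal} := by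
    have h_real : ∫⁻ ω, f ω ∂ρ = ∫⁻ ω, ENNReal.ofReal (f ω).toReal ∂ρ :=
      lintegral_congr fun ω =>
        (ENNReal.ofReal_toReal ((hf1 ω).trans_lt ENNReal.one_lt_top).ne).symm
    rw [h_real, lintegral_eq_lintegral_meas_le ρ
        (Filter.Eventually.of_forall fun ω => ENNReal.toReal_nonneg)
        hf.ennreal_toReal.aemeasurable, ← Set.Ioc_union_Ioi_eq_Ioi (zero_le_one' ℝ),
      lintegral_union measurableSet_Ioi (Set.Ioc_disjoint_Ioi le_rfl)]
    have h_tail : ∫⁻ t in Set.Ioi (1 : ℝ), ρ {ω | t ≤ (f ω).toReal} = 0 := by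
      refine (setLIntegral_congr_fun measurableSet_Ioi fun t ht => ?_).trans lintegral_zero
      have : {ω | t ≤ (f ω).toReal} = ∅ := by
        ext ω
        have hω : (f ω).toReal ≤ 1 := ENNReal.toReal_mono ENNReal.one_ne_top (hf1 ω)
        simpa using hω.trans_lt ht
      simp [this]
    rw [h_tail, add_zero]
  rw [layer_cake μ, layer_cake ν, ← lintegral_const_mul' _ _ hc]
  calc ∫⁻ t in Set.Ioc (0 : ℝ) 1, μ {ω | t ≤ (f ω).toReal}
      ≤ ∫⁻ t in Set.Ioc (0 : ℝ) 1, (c * ν {ω | t ≤ (f ω).toReal} + d) :=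
        lintegral_mono fun t => h _ (measurableSet_le measurable_const hf.ennreal_toReal)
    _ = (∫⁻ t in Set.Ioc (0 : ℝ) 1, c * ν {ω | t ≤ (f ω).toReal}) + d := by
        rw [lintegral_add_right _ measurable_const]
        simp

/-- Adaptive composition of approximate domination: running `κ` after `μ` is dominated by
running `η` after `ν`, with the constants multiplying and the errors adding up. -/
lemma bind_le_of_measure_le_add {Ω Ω' : Type*} [MeasurableSpace Ω] [MeasurableSpace Ω']
    {μ ν : Measure Ω} [IsProbabilityMeasure μ] {κ η : Kernel Ω Ω'} [IsMarkovKernel κ]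
    {c d c' d' : ENNReal} (hc : c ≠ ⊤)
    (h : ∀ T, MeasurableSet T → μ T ≤ c * ν T + d)
    {T : Set Ω'} (hT : MeasurableSet T) (h' : ∀ ω, κ ω T ≤ c' * η ω T + d') :
    μ.bind κ T ≤ c * c' * ν.bind η T + (d + d') := by
  have hη : Measurable fun ω => c' * η ω T := (η.measurable_coe hT).const_mul c'
  have hmin : Measurable fun ω => min 1 (c' * η ω T) := measurable_const.min hη
  rw [Measure.bind_apply hT κ.measurable.aemeasurable,
    Measure.bind_apply hT η.measurable.aemeasurable]
  calc ∫⁻ ω, κ ω T ∂μ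
      ≤ ∫⁻ ω, (min 1 (c' * η ω T) + d') ∂μ := by
        refine lintegral_mono fun ω => ?_
        rw [← min_add_add_right]
        exact le_min (prob_le_one.trans le_self_add) (h' ω)
    _ = ∫⁻ ω, min 1 (c' * η ω T) ∂μ + d' := by
        rw [lintegral_add_right _ measurable_const]
        simp
    _ ≤ c * ∫⁻ ω, min 1 (c' * η ω T) ∂ν + d + d' := by
        gcongr
        exact lintegral_le_of_measure_le_add hc h hmin fun ω => min_le_left _ _
    _ ≤ c * ∫⁻ ω, c' * η ω T ∂ν + d + d' := by
        gcongr
        exact min_le_right _ _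
    _ = c * c' * ∫⁻ ω, η ω T ∂ν + (d + d') := by
        rw [lintegral_const_mul _ (η.measurable_coe hT), mul_assoc, add_assoc]

lemma isProbabilityMeasure_iterComp {X : Type*} {Θ : Type*} [MeasurableSpace Θ]
    {M : ℕ → X → Kernel Θ Θ} (θ₀ : Θ) (x : X) {k : ℕ}
    (hM : ∀ i < k, IsMarkovKernel (M i x)) :
    IsProbabilityMeasure (iterComp M θ₀ x k) := by
  induction k with
  | zero => exact Measure.dirac.isProbabilityMeasure
  | succ k ih =>
    have := ih fun i hi => hM i (hi.trans k.lt_succ_self)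
    have := hM k k.lt_succ_self
    rw [iterComp]
    infer_instance

/-- Iterated adaptive composition of differentially private mechanisms: if for each `i < k`
and each fixed state `θ` the mechanism `x ↦ M i x θ` is `(ε i, δ i)`-DP (with
`θ ↦ M i x θ` a Markov kernel for each `x`), then the `k`-step composed mechanism
`x ↦ iterComp M θ₀ x k` is `(∑_{i<k} ε i, ∑_{i<k} δ i)`-DP. -/
theorem dp_iterated_composition {X : Type*} {Θ : Type*} [MeasurableSpace Θ]
    (N : X → X → Prop) (k : ℕ) (ε δ : ℕ → ℝ)
    (hε : ∀ i < k, 0 ≤ ε i) (hδ : ∀ i < k, 0 ≤ δ i)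
    (M : ℕ → X → Kernel Θ Θ)
    (hMarkov : ∀ i < k, ∀ x : X, IsMarkovKernel (M i x))
    (hDP : ∀ i < k, ∀ θ : Θ, IsDP (fun x => M i x θ) N (ε i) (δ i))
    (θ₀ : Θ) :
    IsDP (fun x => iterComp M θ₀ x k) N
      (∑ i ∈ Finset.range k, ε i) (∑ i ∈ Finset.range k, δ i) := by
  induction k with
  | zero =>
    intro x x' _ T _
    simp [iterComp]
  | succ k ih =>
    intro x x' hx T hT
    have hk := k.lt_succ_self
    have ih := ih (fun i hi => hε i (hi.trans hk)) (fun i hi => hδ i (hi.trans hk))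
      (fun i hi => hMarkov i (hi.trans hk)) (fun i hi => hDP i (hi.trans hk))
    have := isProbabilityMeasure_iterComp θ₀ x fun i hi => hMarkov i (hi.trans hk) x
    have := hMarkov k hk x
    have hδ_sum : 0 ≤ ∑ i ∈ Finset.range k, δ i :=
      Finset.sum_nonneg fun i hi => hδ i ((Finset.mem_range.1 hi).trans hk)
    rw [Finset.sum_range_succ, Finset.sum_range_succ, Real.exp_add,
      ENNReal.ofReal_mul (Real.exp_nonneg _), ENNReal.ofReal_add hδ_sum (hδ k hk)]
    exact bind_le_of_measure_le_add ENNReal.ofReal_ne_top (ih x x' hx) hT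
      fun θ => hDP k hk θ x x' hx T hT
end
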